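/- arXiv:1610.07270 — 3 statements merged into one kernel-verified Lean document; each statement's English description precedes it below -/
import Mathlib

section
/- Let W = (w₁,w₂,w₃,w₄) and Ŵ = (ŵ₁,ŵ₂,ŵ₃,ŵ₄) be points of ℂ⁴ with w₁w₂ + w₃w₄ = 1 and ŵ₁ŵ₂ + ŵ₃ŵ₄ = 1, and suppose F(W) = F(Ŵ). If w₁ = 0 or w₃ = 0, then Ŵ = W. -/
/-- If two points of the quadric have the same image under `F` and `w₁ = 0` or `w₃ = 0`,
then the two points coincide. -/
theorem stmt5 (w₁ w₂ w₃ w₄ w₁' w₂' w₃' w₄' : ℂ)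
    (hQ : w₁ * w₂ + w₃ * w₄ = 1) (hQ' : w₁' * w₂' + w₃' * w₄' = 1)
    (hF : (w₁, w₃, w₂ * w₃ * w₄ ^ 2 + Complex.I * w₁ * w₂ ^ 2 * w₄)
        = (w₁', w₃', w₂' * w₃' * w₄' ^ 2 + Complex.I * w₁' * w₂' ^ 2 * w₄'))
    (h0 : w₁ = 0 ∨ w₃ = 0) :
    (w₁', w₂', w₃', w₄') = (w₁, w₂, w₃, w₄) := by
  simp only [Prod.mk.injEq] at hF ⊢
  obtain ⟨rfl, rfl, hF⟩ := hF
  rcases h0 with rfl | rfl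
  · have h4 : w₄' = w₄ := by linear_combination w₄ * hQ' - w₄' * hQ
    subst h4
    refine ⟨rfl, ?_, rfl, rfl⟩
    linear_combination (w₂ - w₂') * (w₃ * w₄' + 1) * hQ - w₃ * hF
  · have h2 : w₂' = w₂ := by linear_combination w₂ * hQ' - w₂' * hQ
    subst h2
    refine ⟨rfl, rfl, rfl, ?_⟩
    linear_combination (w₄ - w₄') * (w₁ * w₂' + 1) * hQ + Complex.I * w₁ * hF
      - w₁ ^ 2 * w₂' ^ 2 * (w₄ - w₄') * Complex.I_sq
end

section
/- Let W = (w₁,w₂,w₃,w₄) and Ŵ = (ŵ₁,ŵ₂,ŵ₃,ŵ₄) be points of ℂ⁴ with w₁w₂ + w₃w₄ = 1 and ŵ₁ŵ₂ + ŵ₃ŵ₄ = 1, and suppose F(W) = F(Ŵ), w₁ ≠ 0, and w₃ ≠ 0. Then either Ŵ = W, or ŵ₄ satisfies the quadratic equation (i−1)·w₃²·ŵ₄² + ((1−2i)·w₃ + (i−1)·w₃²·w₄)·ŵ₄ + (i + (1−2i)·w₃w₄ + (i−1)·w₃²w₄²) = 0. -/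
/-- If two points of the quadric have the same image under `F`, with `w₁ ≠ 0` and `w₃ ≠ 0`,
then either they coincide or `w₄'` satisfies the quadratic equation
`(i−1)w₃²w₄'² + ((1−2i)w₃ + (i−1)w₃²w₄)w₄' + (i + (1−2i)w₃w₄ + (i−1)w₃²w₄²) = 0`. -/
theorem stmt6 (w₁ w₂ w₃ w₄ w₁' w₂' w₃' w₄' : ℂ)
    (hQ : w₁ * w₂ + w₃ * w₄ = 1) (hQ' : w₁' * w₂' + w₃' * w₄' = 1)
    (hF : (w₁, w₃, w₂ * w₃ * w₄ ^ 2 + Complex.I * w₁ * w₂ ^ 2 * w₄)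
        = (w₁', w₃', w₂' * w₃' * w₄' ^ 2 + Complex.I * w₁' * w₂' ^ 2 * w₄'))
    (hw₁ : w₁ ≠ 0) (hw₃ : w₃ ≠ 0) :
    (w₁', w₂', w₃', w₄') = (w₁, w₂, w₃, w₄) ∨
    (Complex.I - 1) * w₃ ^ 2 * w₄' ^ 2
      + ((1 - 2 * Complex.I) * w₃ + (Complex.I - 1) * w₃ ^ 2 * w₄) * w₄'
      + (Complex.I + (1 - 2 * Complex.I) * (w₃ * w₄)
          + (Complex.I - 1) * w₃ ^ 2 * w₄ ^ 2) = 0 := by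
  simp only [Prod.mk.injEq] at hF
  obtain ⟨rfl, rfl, h⟩ := hF
  have h₂ : w₁ * w₂ = 1 - w₃ * w₄ := by linear_combination hQ
  have h₂' : w₁ * w₂' = 1 - w₃ * w₄' := by linear_combination hQ'
  have hcubic : (1 - w₃ * w₄) * w₃ * w₄ ^ 2 + Complex.I * (1 - w₃ * w₄) ^ 2 * w₄
      = (1 - w₃ * w₄') * w₃ * w₄' ^ 2 + Complex.I * (1 - w₃ * w₄') ^ 2 * w₄' := by
    rw [← h₂, ← h₂']
    linear_combination w₁ * h
  by_cases h₄ : w₄' = w₄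
  · left
    subst h₄
    rw [mul_left_cancel₀ hw₁ (h₂'.trans h₂.symm)]
  · right
    apply mul_left_cancel₀ (sub_ne_zero.mpr h₄)
    linear_combination -hcubic
end

section
/- For every point V ∈ ℂ³, the set of points W ∈ ℂ⁴ with w₁w₂ + w₃w₄ = 1 and F(W) = V contains at most three elements. -/
/-- The map `F` restricted to the quadric `Q³`. -/
noncomputable def F (w : ℂ × ℂ × ℂ × ℂ) : ℂ × ℂ × ℂ :=
  (w.1, w.2.2.1, w.2.1 * w.2.2.1 * w.2.2.2 ^ 2 + Complex.I * w.1 * w.2.1 ^ 2 * w.2.2.2)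

/-- The roots of a complex cubic are contained in a set of three elements. -/
theorem exists_three_roots_of_cubic {p q r s : ℂ} (hp : p ≠ 0) :
    ∃ x y z : ℂ, ∀ t : ℂ, p * t ^ 3 + q * t ^ 2 + r * t + s = 0 → t = x ∨ t = y ∨ t = z := by
  obtain ⟨x, y, z, h⟩ :=
    (Cubic.splits_iff_roots_eq_three (P := ⟨p, q, r, s⟩) (φ := RingHom.id ℂ) hp).1
      (IsAlgClosed.splits _)
  refine ⟨x, y, z, fun t ht => ?_⟩
  have hprod := Cubic.eq_prod_three_roots (P := ⟨p, q, r, s⟩) (φ := RingHom.id ℂ) hp h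
  have heval := congrArg (Polynomial.eval t) hprod
  simp [Cubic.map, Cubic.toPoly, ht, hp, sub_eq_zero] at heval
  tauto

/-- Every fiber of `F` over the quadric contains at most three points. -/
theorem stmt9 (V : ℂ × ℂ × ℂ) :
    ∃ a b c : ℂ × ℂ × ℂ × ℂ,
      {W : ℂ × ℂ × ℂ × ℂ | W.1 * W.2.1 + W.2.2.1 * W.2.2.2 = 1 ∧ F W = V} ⊆ {a, b, c} := by
  obtain ⟨a, b, v⟩ := V
  by_cases hb : b = 0
  · subst hb
    refine ⟨(a, a⁻¹, 0, -Complex.I * a * v), 0, 0, ?_⟩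
    rintro ⟨a', x, b', y⟩ ⟨hW, hF⟩
    simp only [F, Prod.mk.injEq] at hW hF
    obtain ⟨rfl, rfl, hv⟩ := hF
    have hax : a' * x = 1 := by linear_combination hW
    left
    simp only [Prod.mk.injEq, true_and]
    refine ⟨eq_inv_of_mul_eq_one_right hax, ?_⟩
    linear_combination -Complex.I * a' * hv + y * (a' * x) ^ 2 * Complex.I_sq
      - y * (a' * x + 1) * hax
  by_cases ha : a = 0
  · subst ha
    refine ⟨(0, b * v, b, b⁻¹), 0, 0, ?_⟩
    rintro ⟨a', x, b', y⟩ ⟨hW, hF⟩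
    simp only [F, Prod.mk.injEq] at hW hF
    obtain ⟨rfl, rfl, hv⟩ := hF
    have hby : b' * y = 1 := by linear_combination hW
    left
    simp only [Prod.mk.injEq, true_and]
    refine ⟨?_, eq_inv_of_mul_eq_one_right hby⟩
    linear_combination b' * hv - x * (b' * y + 1) * hby
  have hI : (1 - Complex.I) * a ^ 2 ≠ 0 := by
    refine mul_ne_zero (fun h => ?_) (pow_ne_zero 2 ha)
    simpa using congrArg Complex.re h
  obtain ⟨x₁, x₂, x₃, h⟩ :=
    exists_three_roots_of_cubic (q := (Complex.I - 2) * a) (r := 1) (s := -(b * v)) hI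
  refine ⟨(a, x₁, b, (1 - a * x₁) / b), (a, x₂, b, (1 - a * x₂) / b),
    (a, x₃, b, (1 - a * x₃) / b), ?_⟩
  rintro ⟨a', x, b', y⟩ ⟨hW, hF⟩
  simp only [F, Prod.mk.injEq] at hW hF
  obtain ⟨rfl, rfl, hv⟩ := hF
  have hy : y = (1 - a' * x) / b' := by
    field_simp
    linear_combination hW
  have hx := h x (by
    rw [← hv, hy]
    field_simp
    ring)
  rcases hx with rfl | rfl | rfl <;> simp [hy]
end
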